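/- arXiv:1502.02018 — 2 statements merged into one kernel-verified Lean document; each statement's English description precedes it below -/
import Mathlib

section
/- Let u_1, u_2 ∈ M_3 be hermitian. If the expected value map 𝔼|_{𝓜_3} is not open at some state in the fiber 𝔼|_{𝓜_3}^{-1}(z) of a point z ∈ W(u_1,u_2), then z is a multiply generated round boundary point of W(u_1,u_2) and the matrix u_1 + i·u_2 is unitarily equivalent to a block-diagonal matrix B ⊕ [z], where B is a unitarily irreducible 2×2 matrix and (identifying ℝ² ≅ ℂ) z is a boundary point of W(u_1,u_2). -/
open Set Filter Topology Matrix
open scoped ComplexOrder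

/-- The joint numerical range `W(u₁,u₂) ⊆ ℝ²` of two (hermitian) matrices. -/
def jointNR {d : ℕ} (u₁ u₂ : Matrix (Fin d) (Fin d) ℂ) : Set (ℝ × ℝ) :=
  {p | ∃ x : Fin d → ℂ, star x ⬝ᵥ x = 1 ∧
    p = ((star x ⬝ᵥ u₁.mulVec x).re, (star x ⬝ᵥ u₂.mulVec x).re)}

/-- The state space `𝓜_d`: positive semidefinite matrices of trace one. -/
def stateSpace (d : ℕ) : Set (Matrix (Fin d) (Fin d) ℂ) :=
  {ρ | ρ.PosSemidef ∧ ρ.trace = 1}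

/-- The expected value map `ρ ↦ (tr(u₁ρ), tr(u₂ρ))` (real for hermitian arguments). -/
noncomputable def expVal2 {d : ℕ} (u₁ u₂ : Matrix (Fin d) (Fin d) ℂ)
    (ρ : Matrix (Fin d) (Fin d) ℂ) : ℝ × ℝ :=
  ((u₁ * ρ).trace.re, (u₂ * ρ).trace.re)

/-- `f` restricted to `K` (viewed as a map onto `L`, both with subspace topologies) is open at
`v ∈ K` if the image of every neighborhood of `v` in `K` is a neighborhood of `f v` in `L`. -/
def MapsOpenAt {X Y : Type*} [TopologicalSpace X] [TopologicalSpace Y]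
    (f : X → Y) (K : Set X) (L : Set Y) (v : X) : Prop :=
  ∀ N : Set X, N ⊆ K → N ∈ nhdsWithin v K → f '' N ∈ nhdsWithin (f v) L

/-- A supporting line of `C` at `p`: the level set of a nonzero linear functional attaining
its maximum over `C` at `p`. -/
def IsSupportingLineAt (C : Set (ℝ × ℝ)) (p : ℝ × ℝ) (l : Set (ℝ × ℝ)) : Prop :=
  ∃ (φ : (ℝ × ℝ) →ₗ[ℝ] ℝ) (c : ℝ), φ ≠ 0 ∧ l = {q | φ q = c} ∧ φ p = c ∧ ∀ q ∈ C, φ q ≤ c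

/-- A corner point of `C`: a point of `C` lying on more than one supporting line. -/
def IsCornerPoint (C : Set (ℝ × ℝ)) (p : ℝ × ℝ) : Prop :=
  p ∈ C ∧ ∃ l₁ l₂ : Set (ℝ × ℝ), l₁ ≠ l₂ ∧ IsSupportingLineAt C p l₁ ∧ IsSupportingLineAt C p l₂

/-- A round boundary point of `C`: a boundary point which is neither a corner point nor lies
in the relative interior of a flat boundary portion (a nondegenerate segment in the boundary). -/
def IsRoundBoundaryPoint (C : Set (ℝ × ℝ)) (p : ℝ × ℝ) : Prop :=
  p ∈ frontier C ∧ ¬ IsCornerPoint C p ∧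
    ¬ ∃ a b : ℝ × ℝ, a ≠ b ∧ segment ℝ a b ⊆ frontier C ∧ p ∈ openSegment ℝ a b

/-- `z` is singularly generated if all unit vectors generating it are proportional. -/
def SinglyGenerated {d : ℕ} (u₁ u₂ : Matrix (Fin d) (Fin d) ℂ) (z : ℝ × ℝ) : Prop :=
  ∀ x y : Fin d → ℂ, star x ⬝ᵥ x = 1 → star y ⬝ᵥ y = 1 →
    ((star x ⬝ᵥ u₁.mulVec x).re, (star x ⬝ᵥ u₂.mulVec x).re) = z →
    ((star y ⬝ᵥ u₁.mulVec y).re, (star y ⬝ᵥ u₂.mulVec y).re) = z →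
    ∃ c : ℂ, y = c • x

/-- `z` is multiply generated if it lies in the joint numerical range but is not
singularly generated. -/
def MultiplyGenerated {d : ℕ} (u₁ u₂ : Matrix (Fin d) (Fin d) ℂ) (z : ℝ × ℝ) : Prop :=
  z ∈ jointNR u₁ u₂ ∧ ¬ SinglyGenerated u₁ u₂ z

/-- A matrix is unitarily reducible if it is unitarily equivalent to a block diagonal matrix
with (at least) two proper diagonal blocks. -/
def UnitarilyReducible {d : ℕ} (A : Matrix (Fin d) (Fin d) ℂ) : Prop :=
  ∃ (a b : ℕ) (hab : a + b = d), 0 < a ∧ 0 < b ∧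
    ∃ U ∈ Matrix.unitaryGroup (Fin d) ℂ,
      ∃ (B : Matrix (Fin a) (Fin a) ℂ) (C : Matrix (Fin b) (Fin b) ℂ),
        star U * A * U =
          Matrix.reindex (finSumFinEquiv.trans (finCongr hab))
            (finSumFinEquiv.trans (finCongr hab)) (Matrix.fromBlocks B 0 0 C)

/-- A simplex is the convex hull of finitely many affinely independent points. -/
def IsSimplex {Y : Type*} [AddCommGroup Y] [Module ℝ Y] (S : Set Y) : Prop :=
  ∃ s : Finset Y, AffineIndependent ℝ (fun p : (s : Set Y) => (p : Y)) ∧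
    S = convexHull ℝ (s : Set Y)

/-- `w` is a simplicial point of `C` if finitely many simplices contained in `C`
cover a neighborhood of `w` in `C`. -/
def IsSimplicialPoint {Y : Type*} [AddCommGroup Y] [Module ℝ Y] [TopologicalSpace Y]
    (C : Set Y) (w : Y) : Prop :=
  ∃ (m : ℕ) (S : Fin m → Set Y),
    (∀ i, IsSimplex (S i) ∧ S i ⊆ C) ∧ (⋃ i, S i) ∈ nhdsWithin w C

/-- A face of a convex set `C`: a convex subset `F ⊆ C` such that any segment of `C` whose
relative interior meets `F` lies in `F` (i.e. `F` is convex and extreme in `C`). -/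
def IsFaceOf {Y : Type*} [AddCommGroup Y] [Module ℝ Y] (C F : Set Y) : Prop :=
  Convex ℝ F ∧ IsExtreme ℝ C F

/-- The dimension of a convex set: the dimension of its affine hull. -/
noncomputable def convDim {Y : Type*} [NormedAddCommGroup Y] [NormedSpace ℝ Y]
    (C : Set Y) : ℕ :=
  Module.finrank ℝ (affineSpan ℝ C).direction

section StateSpace

variable {d : ℕ}

lemma Matrix.PosSemidef.normSq_apply_le {A : Matrix (Fin d) (Fin d) ℂ} (hA : A.PosSemidef)
    (i j : Fin d) : Complex.normSq (A i j) ≤ (A i i).re * (A j j).re := by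
  have h := (hA.submatrix ![i, j]).det_nonneg
  have hji : A j i = star (A i j) := (hA.isHermitian.apply j i).symm
  have hi := hA.isHermitian.apply i i
  have hj := hA.isHermitian.apply j j
  have hi' : (A i i).im = 0 := Complex.conj_eq_iff_im.1 hi
  have hj' : (A j j).im = 0 := Complex.conj_eq_iff_im.1 hj
  rw [Matrix.det_fin_two] at h
  have h' := (Complex.le_def.1 h).1
  simp [hji, hi', hj', Complex.mul_conj] at h'
  exact h'

lemma Matrix.PosSemidef.apply_eq_zero {A : Matrix (Fin d) (Fin d) ℂ} (hA : A.PosSemidef)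
    {i : Fin d} (hi : (A i i).re = 0) (j : Fin d) : A i j = 0 ∧ A j i = 0 := by
  constructor
  · have h := hA.normSq_apply_le i j
    rw [hi, zero_mul] at h
    exact Complex.normSq_eq_zero.1 (le_antisymm h (Complex.normSq_nonneg _))
  · have h := hA.normSq_apply_le j i
    rw [hi, mul_zero] at h
    exact Complex.normSq_eq_zero.1 (le_antisymm h (Complex.normSq_nonneg _))

lemma Matrix.PosSemidef.re_diag_nonneg {A : Matrix (Fin d) (Fin d) ℂ} (hA : A.PosSemidef)
    (i : Fin d) : 0 ≤ (A i i).re := (Complex.le_def.1 hA.diag_nonneg).1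

lemma re_diag_le_one {ρ : Matrix (Fin d) (Fin d) ℂ} (hρ : ρ ∈ stateSpace d) (i : Fin d) :
    (ρ i i).re ≤ 1 := by
  have h : (∑ k, (ρ k k).re) = 1 := by
    have := congrArg Complex.re hρ.2
    simpa [Matrix.trace] using this
  rw [← h]
  exact Finset.single_le_sum (f := fun k => (ρ k k).re)
    (fun k _ => hρ.1.re_diag_nonneg k) (Finset.mem_univ i)

lemma norm_apply_le_one {ρ : Matrix (Fin d) (Fin d) ℂ} (hρ : ρ ∈ stateSpace d) (i j : Fin d) :
    ‖ρ i j‖ ≤ 1 := by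
  have h := hρ.1.normSq_apply_le i j
  rw [Complex.normSq_eq_norm_sq] at h
  have : (ρ i i).re * (ρ j j).re ≤ 1 :=
    mul_le_one₀ (re_diag_le_one hρ i) (hρ.1.re_diag_nonneg j) (re_diag_le_one hρ j)
  nlinarith [norm_nonneg (ρ i j)]

lemma isCompact_stateSpace (d : ℕ) : IsCompact (stateSpace d) := by
  have hcl : IsClosed (stateSpace d) := by
    have : stateSpace d = {ρ | ρᴴ = ρ} ∩ (⋂ x : Fin d → ℂ, {ρ | 0 ≤ star x ⬝ᵥ ρ.mulVec x})
        ∩ {ρ | ρ.trace = 1} := by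
      ext ρ
      simp [stateSpace, Matrix.posSemidef_iff_dotProduct_mulVec, Matrix.IsHermitian]
    rw [this]
    refine IsClosed.inter (IsClosed.inter ?_ (isClosed_iInter fun x => ?_)) ?_
    · exact isClosed_eq (by fun_prop) continuous_id
    · exact isClosed_le continuous_const (by fun_prop)
    · exact isClosed_eq (by fun_prop) continuous_const
  have hK : IsCompact (Set.univ.pi fun _ : Fin d => Set.univ.pi fun _ : Fin d =>
      Metric.closedBall (0 : ℂ) 1) :=
    isCompact_univ_pi fun _ => isCompact_univ_pi fun _ => isCompact_closedBall _ _
  refine hK.of_isClosed_subset hcl fun ρ hρ i _ j _ => ?_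
  simpa using norm_apply_le_one hρ i j

lemma convex_stateSpace (d : ℕ) : Convex ℝ (stateSpace d) := by
  intro ρ hρ σ hσ a b ha hb hab
  refine ⟨(hρ.1.smul ha).add (hσ.1.smul hb), ?_⟩
  rw [Matrix.trace_add, Matrix.trace_smul, Matrix.trace_smul, hρ.2, hσ.2, ← add_smul, hab, one_smul]

lemma conj_mem_stateSpace {ρ U : Matrix (Fin d) (Fin d) ℂ} (hU : U ∈ Matrix.unitaryGroup (Fin d) ℂ)
    (hρ : ρ ∈ stateSpace d) : star U * ρ * U ∈ stateSpace d := by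
  refine ⟨hρ.1.conjTranspose_mul_mul_same U, ?_⟩
  rw [Matrix.trace_mul_cycle, Matrix.mem_unitaryGroup_iff.1 hU, one_mul, hρ.2]

lemma trace_conj_mul_conj {U : Matrix (Fin d) (Fin d) ℂ} (hU : U ∈ Matrix.unitaryGroup (Fin d) ℂ)
    (A ρ : Matrix (Fin d) (Fin d) ℂ) :
    ((star U * A * U) * (star U * ρ * U)).trace = (A * ρ).trace := by
  have h := Matrix.mem_unitaryGroup_iff.1 hU
  have : (star U * A * U) * (star U * ρ * U) = star U * (A * ρ) * U := by
    calc _ = star U * A * (U * star U) * ρ * U := by simp only [mul_assoc]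
      _ = _ := by rw [h]; simp only [mul_assoc, mul_one]
  rw [this, Matrix.trace_mul_cycle, h, one_mul]

lemma pure_mem_stateSpace {x : Fin d → ℂ} (hx : star x ⬝ᵥ x = 1) :
    Matrix.vecMulVec x (star x) ∈ stateSpace d :=
  ⟨Matrix.posSemidef_vecMulVec_self_star x, by
    rw [Matrix.trace_vecMulVec, dotProduct_comm, hx]⟩

lemma trace_mul_pure (A : Matrix (Fin d) (Fin d) ℂ) (x : Fin d → ℂ) :
    (A * Matrix.vecMulVec x (star x)).trace = star x ⬝ᵥ A.mulVec x := by
  rw [Matrix.mul_vecMulVec, Matrix.trace_vecMulVec, dotProduct_comm]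

lemma jointNR_subset (u₁ u₂ : Matrix (Fin d) (Fin d) ℂ) :
    jointNR u₁ u₂ ⊆ expVal2 u₁ u₂ '' stateSpace d := by
  rintro _ ⟨x, hx, rfl⟩
  exact ⟨_, pure_mem_stateSpace hx, by simp only [expVal2, trace_mul_pure]⟩

lemma expVal2_combo (u₁ u₂ ρ σ : Matrix (Fin d) (Fin d) ℂ) (a b : ℝ) :
    expVal2 u₁ u₂ (a • ρ + b • σ) = a • expVal2 u₁ u₂ ρ + b • expVal2 u₁ u₂ σ := by
  simp [expVal2, Matrix.mul_add, Matrix.trace_add, Matrix.trace_smul]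

lemma continuous_expVal2 (u₁ u₂ : Matrix (Fin d) (Fin d) ℂ) : Continuous (expVal2 u₁ u₂) := by
  unfold expVal2
  fun_prop

lemma convex_expVal2_image (u₁ u₂ : Matrix (Fin d) (Fin d) ℂ) :
    Convex ℝ (expVal2 u₁ u₂ '' stateSpace d) := by
  rintro _ ⟨ρ, hρ, rfl⟩ _ ⟨σ, hσ, rfl⟩ a b ha hb hab
  exact ⟨_, convex_stateSpace d hρ hσ ha hb hab, expVal2_combo ..⟩

end StateSpace

section Openness

variable {d : ℕ} {u₁ u₂ ρ : Matrix (Fin d) (Fin d) ℂ}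

lemma mapsOpenAt_of_tendsto {X Y : Type*} [TopologicalSpace X] [TopologicalSpace Y]
    {f : X → Y} {K : Set X} {L : Set Y} {v : X} (g : Y → X)
    (hg : ∀ᶠ w in 𝓝[L] f v, g w ∈ K ∧ f (g w) = w) (ht : Tendsto g (𝓝[L] f v) (𝓝 v)) :
    MapsOpenAt f K L v := by
  intro N _ hN
  have ht' : Tendsto g (𝓝[L] f v) (𝓝[K] v) :=
    tendsto_nhdsWithin_iff.2 ⟨ht, hg.mono fun _ h => h.1⟩
  filter_upwards [ht' hN, hg] with w hw hw'
  exact ⟨g w, hw, hw'.2⟩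

lemma mapsOpenAt_of_unique
    (h : ∀ σ ∈ stateSpace d, expVal2 u₁ u₂ σ = expVal2 u₁ u₂ ρ → σ = ρ) :
    MapsOpenAt (expVal2 u₁ u₂) (stateSpace d) (jointNR u₁ u₂) ρ := by
  choose! g hg using fun w (hw : w ∈ jointNR u₁ u₂) => jointNR_subset u₁ u₂ hw
  have hev : ∀ᶠ w in 𝓝[jointNR u₁ u₂] expVal2 u₁ u₂ ρ,
      g w ∈ stateSpace d ∧ expVal2 u₁ u₂ (g w) = w :=
    eventually_mem_nhdsWithin.mono hg
  refine mapsOpenAt_of_tendsto g hev ?_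
  refine (isCompact_stateSpace d).tendsto_nhds_of_unique_mapClusterPt
    (hev.mono fun _ h => h.1) fun σ hσ hc => h σ hσ ?_
  have h1 : MapClusterPt (expVal2 u₁ u₂ σ) (𝓝[jointNR u₁ u₂] expVal2 u₁ u₂ ρ)
      (expVal2 u₁ u₂ ∘ g) := hc.continuousAt_comp (continuous_expVal2 u₁ u₂).continuousAt
  have h2 : Tendsto (expVal2 u₁ u₂ ∘ g) (𝓝[jointNR u₁ u₂] expVal2 u₁ u₂ ρ)
      (𝓝 (expVal2 u₁ u₂ ρ)) :=
    (tendsto_id.mono_left nhdsWithin_le_nhds).congr' (hev.mono fun w hw => hw.2.symm)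
  have h3 : ClusterPt (expVal2 u₁ u₂ σ) (𝓝 (expVal2 u₁ u₂ ρ)) := ClusterPt.mono h1 h2
  exact eq_of_nhds_neBot h3

lemma mapsOpenAt_of_cone (hρ : ρ ∈ stateSpace d) (K : ℝ)
    (h : ∀ w ∈ jointNR u₁ u₂, ∃ σ₁ ∈ stateSpace d, ∃ σ₂ ∈ stateSpace d, ∃ t₁ t₂ : ℝ,
      0 ≤ t₁ ∧ 0 ≤ t₂ ∧ t₁ + t₂ ≤ K * ‖w - expVal2 u₁ u₂ ρ‖ ∧
      w - expVal2 u₁ u₂ ρ = t₁ • (expVal2 u₁ u₂ σ₁ - expVal2 u₁ u₂ ρ) +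
        t₂ • (expVal2 u₁ u₂ σ₂ - expVal2 u₁ u₂ ρ)) :
    MapsOpenAt (expVal2 u₁ u₂) (stateSpace d) (jointNR u₁ u₂) ρ := by
  choose! σ₁ hσ₁ σ₂ hσ₂ t₁ t₂ ht₁ ht₂ ht he using h
  set z := expVal2 u₁ u₂ ρ with hz
  have h0 : Tendsto (fun w => K * ‖w - z‖) (𝓝[jointNR u₁ u₂] z) (𝓝 0) := by
    have : Continuous fun w : ℝ × ℝ => K * ‖w - z‖ := by fun_prop
    simpa using (this.tendsto z).mono_left nhdsWithin_le_nhds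
  refine mapsOpenAt_of_tendsto
    (fun w => (1 - (t₁ w + t₂ w)) • ρ + (1 : ℝ) • (t₁ w • σ₁ w + t₂ w • σ₂ w)) ?_ ?_
  · filter_upwards [eventually_mem_nhdsWithin, h0.eventually (gt_mem_nhds one_pos)] with w hw h1
    have hs := ht w hw
    constructor
    · rw [one_smul, ← add_assoc]
      have := (convex_stateSpace d).sum_mem (t := Finset.univ)
        (w := ![1 - (t₁ w + t₂ w), t₁ w, t₂ w]) (z := ![ρ, σ₁ w, σ₂ w])
        (by
          intro i _
          fin_cases i
          · simp; linarith
          · exact ht₁ w hw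
          · exact ht₂ w hw)
        (by simp [Fin.sum_univ_three]; ring)
        (by
          intro i _
          fin_cases i
          · exact hρ
          · exact hσ₁ w hw
          · exact hσ₂ w hw)
      simpa [Fin.sum_univ_three] using this
    · rw [expVal2_combo, expVal2_combo, ← hz]
      have := he w hw
      rw [sub_eq_iff_eq_add] at this
      conv_rhs => rw [this]
      module
  · refine tendsto_pi_nhds.2 fun i => tendsto_pi_nhds.2 fun j => ?_
    rw [tendsto_iff_norm_sub_tendsto_zero]
    refine squeeze_zero' (Eventually.of_forall fun _ => norm_nonneg _) ?_
      (by simpa using h0.const_mul 2 : Tendsto (fun w => 2 * (K * ‖w - z‖)) _ _)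
    filter_upwards [eventually_mem_nhdsWithin] with w hw
    have e : ((1 - (t₁ w + t₂ w)) • ρ + (1 : ℝ) • (t₁ w • σ₁ w + t₂ w • σ₂ w)) i j - ρ i j
        = t₁ w • (σ₁ w i j - ρ i j) + t₂ w • (σ₂ w i j - ρ i j) := by
      simp only [Matrix.add_apply, Matrix.smul_apply]
      module
    have b : ∀ σ ∈ stateSpace d, ‖σ i j - ρ i j‖ ≤ 2 := fun σ hσ =>
      (norm_sub_le _ _).trans (by linarith [norm_apply_le_one hσ i j, norm_apply_le_one hρ i j])
    rw [e]
    refine (norm_add_le _ _).trans ?_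
    rw [norm_smul, norm_smul, Real.norm_of_nonneg (ht₁ w hw), Real.norm_of_nonneg (ht₂ w hw)]
    have := mul_le_mul_of_nonneg_left (b _ (hσ₁ w hw)) (ht₁ w hw)
    have := mul_le_mul_of_nonneg_left (b _ (hσ₂ w hw)) (ht₂ w hw)
    linarith [ht w hw]

end Openness

section Support

lemma linearMap_prod_apply (φ : (ℝ × ℝ) →ₗ[ℝ] ℝ) (w : ℝ × ℝ) :
    φ w = φ (1, 0) * w.1 + φ (0, 1) * w.2 := by
  have : w = w.1 • ((1 : ℝ), (0 : ℝ)) + w.2 • ((0 : ℝ), (1 : ℝ)) := by ext <;> simp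
  conv_lhs => rw [this, map_add, map_smul, map_smul]
  simp only [smul_eq_mul]
  ring

lemma linearMap_prod_ne_zero {φ : (ℝ × ℝ) →ₗ[ℝ] ℝ} (h : φ ≠ 0) :
    0 < φ (1, 0) ^ 2 + φ (0, 1) ^ 2 := by
  by_contra hn
  have h1 : φ (1, 0) = 0 := by nlinarith [sq_nonneg (φ (1, 0)), sq_nonneg (φ (0, 1))]
  have h2 : φ (0, 1) = 0 := by nlinarith [sq_nonneg (φ (1, 0)), sq_nonneg (φ (0, 1))]
  exact h (LinearMap.ext fun w => by rw [linearMap_prod_apply, h1, h2]; simp)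

lemma exists_support_of_notMem_interior {C : Set (ℝ × ℝ)} (hC : Convex ℝ C) {z : ℝ × ℝ}
    (hzC : z ∈ C) (hz : z ∉ interior C) :
    ∃ φ : (ℝ × ℝ) →ₗ[ℝ] ℝ, φ ≠ 0 ∧ ∀ w ∈ C, φ w ≤ φ z := by
  rcases (interior C).eq_empty_or_nonempty with he | hne
  · have hsp : affineSpan ℝ C ≠ ⊤ := fun h => by
      rw [← hC.interior_nonempty_iff_affineSpan_eq_top, he] at h
      exact Set.not_nonempty_empty h
    have hdir : (affineSpan ℝ C).direction < ⊤ := lt_top_iff_ne_top.2 fun h => hsp <|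
      (AffineSubspace.direction_eq_top_iff_of_nonempty
        ⟨z, subset_affineSpan ℝ C hzC⟩).1 h
    obtain ⟨φ, hφ, hk⟩ := Submodule.exists_le_ker_of_lt_top _ hdir
    refine ⟨φ, hφ, fun w hw => ?_⟩
    have : φ (w -ᵥ z) = 0 := hk <| AffineSubspace.vsub_mem_direction
      (subset_affineSpan ℝ C hw) (subset_affineSpan ℝ C hzC)
    rw [vsub_eq_sub, map_sub] at this
    linarith
  · obtain ⟨f, hf, hle⟩ := geometric_hahn_banach_of_nonempty_interior_point hC hz hne
    exact ⟨f.toLinearMap, fun h => hf (by ext <;> simpa using LinearMap.congr_fun h _), hle⟩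

variable {d : ℕ} {u₁ u₂ ρ : Matrix (Fin d) (Fin d) ℂ}

/-- The operator whose expected value at a state `σ` is `α (z₁ - 𝔼(σ)₁) + β (z₂ - 𝔼(σ)₂)`. -/
noncomputable def gapMatrix (u₁ u₂ : Matrix (Fin d) (Fin d) ℂ) (z : ℝ × ℝ) (α β : ℝ) :
    Matrix (Fin d) (Fin d) ℂ :=
  (α * z.1 + β * z.2 : ℝ) • (1 : Matrix (Fin d) (Fin d) ℂ) - α • u₁ - β • u₂

lemma trace_gapMatrix_mul (z : ℝ × ℝ) (α β : ℝ) (hρ : ρ.trace = 1) :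
    (gapMatrix u₁ u₂ z α β * ρ).trace.re =
      α * (z.1 - (expVal2 u₁ u₂ ρ).1) + β * (z.2 - (expVal2 u₁ u₂ ρ).2) := by
  simp [gapMatrix, sub_mul, Matrix.trace_sub, Matrix.trace_smul, hρ, expVal2]
  ring

lemma gapMatrix_isHermitian (h₁ : u₁.IsHermitian) (h₂ : u₂.IsHermitian) (z : ℝ × ℝ) (α β : ℝ) :
    (gapMatrix u₁ u₂ z α β).IsHermitian := by
  have hs : ∀ (r : ℝ) (A : Matrix (Fin d) (Fin d) ℂ), A.IsHermitian → (r • A).IsHermitian := by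
    intro r A hA
    rw [Matrix.IsHermitian, Matrix.conjTranspose_smul, hA, star_trivial]
  exact ((hs _ _ Matrix.isHermitian_one).sub (hs _ _ h₁)).sub (hs _ _ h₂)

lemma gapMatrix_posSemidef (h₁ : u₁.IsHermitian) (h₂ : u₂.IsHermitian) {z : ℝ × ℝ}
    {φ : (ℝ × ℝ) →ₗ[ℝ] ℝ} (h : ∀ w ∈ jointNR u₁ u₂, φ w ≤ φ z) :
    (gapMatrix u₁ u₂ z (φ (1, 0)) (φ (0, 1))).PosSemidef := by
  set M := gapMatrix u₁ u₂ z (φ (1, 0)) (φ (0, 1)) with hM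
  have hherm : M.IsHermitian := gapMatrix_isHermitian h₁ h₂ z _ _
  have key : ∀ x : Fin d → ℂ, star x ⬝ᵥ x = 1 → 0 ≤ (star x ⬝ᵥ M.mulVec x).re := by
    intro x hx
    rw [← trace_mul_pure, hM, trace_gapMatrix_mul _ _ _ (pure_mem_stateSpace hx).2]
    have := h _ ⟨x, hx, rfl⟩
    rw [linearMap_prod_apply φ z, linearMap_prod_apply φ (_, _)] at this
    simp only [expVal2, trace_mul_pure]
    linarith
  refine Matrix.PosSemidef.of_dotProduct_mulVec_nonneg hherm fun x => ?_
  have him : (star x ⬝ᵥ M.mulVec x).im = 0 := by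
    simpa using hherm.im_star_dotProduct_mulVec_self x
  refine Complex.le_def.2 ⟨?_, by simpa using him.symm⟩
  obtain ⟨r, hr0, hr⟩ : ∃ r : ℝ, 0 ≤ r ∧ star x ⬝ᵥ x = (r : ℂ) := by
    have h0 : 0 ≤ star x ⬝ᵥ x := dotProduct_star_self_nonneg x
    have := Complex.le_def.1 h0
    exact ⟨_, this.1, Complex.ext rfl (by simpa using this.2.symm)⟩
  rcases hr0.eq_or_lt with h0 | hpos
  · have : x = 0 := by
      rw [← h0] at hr
      exact dotProduct_star_self_eq_zero.1 (by simpa using hr)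
    simp [this]
  · have hs : (Real.sqrt r) ^ 2 = r := Real.sq_sqrt hr0
    have hsp : 0 < Real.sqrt r := Real.sqrt_pos.2 hpos
    have e : x = (Real.sqrt r) • ((Real.sqrt r)⁻¹ • x) := by
      rw [smul_smul, mul_inv_cancel₀ hsp.ne', one_smul]
    have hu := key ((Real.sqrt r)⁻¹ • x) (by
      rw [star_smul, smul_dotProduct, dotProduct_smul, hr, smul_smul, star_trivial, ← mul_inv,
        ← sq, hs, Complex.real_smul]
      push_cast
      exact inv_mul_cancel₀ (by exact_mod_cast hpos.ne'))
    rw [e, star_smul, smul_dotProduct, Matrix.mulVec_smul, dotProduct_smul, Complex.smul_re,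
      Complex.smul_re]
    simp only [star_trivial, smul_eq_mul]
    positivity

lemma exists_ray_bound (hρ : ρ ∈ stateSpace d) (v : ℝ × ℝ) :
    ∃ K : ℝ, 0 ≤ K ∧ ∀ s : ℝ, 0 ≤ s →
      expVal2 u₁ u₂ ρ + s • v ∈ expVal2 u₁ u₂ '' stateSpace d →
      ∃ σ ∈ stateSpace d, ∃ t : ℝ, 0 ≤ t ∧ t ≤ K * s ∧
        s • v = t • (expVal2 u₁ u₂ σ - expVal2 u₁ u₂ ρ) := by
  by_cases h : ∃ s : ℝ, 0 < s ∧ expVal2 u₁ u₂ ρ + s • v ∈ expVal2 u₁ u₂ '' stateSpace d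
  · obtain ⟨s₀, hs₀, σ, hσ, he⟩ := h
    refine ⟨s₀⁻¹, by positivity, fun s hs _ => ⟨σ, hσ, s₀⁻¹ * s, by positivity, le_rfl, ?_⟩⟩
    rw [he, add_sub_cancel_left, smul_smul]
    congr 1
    field_simp
  · refine ⟨0, le_rfl, fun s hs hmem => ⟨ρ, hρ, 0, le_rfl, by simp, ?_⟩⟩
    rcases hs.eq_or_lt with h0 | hpos
    · simp [← h0]
    · exact (h ⟨s, hpos, hmem⟩).elim

lemma mapsOpenAt_of_image_subset_line (hρ : ρ ∈ stateSpace d) {φ : (ℝ × ℝ) →ₗ[ℝ] ℝ}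
    (hφ : φ ≠ 0)
    (h : ∀ σ ∈ stateSpace d, φ (expVal2 u₁ u₂ σ) = φ (expVal2 u₁ u₂ ρ)) :
    MapsOpenAt (expVal2 u₁ u₂) (stateSpace d) (jointNR u₁ u₂) ρ := by
  set a := φ (1, 0)
  set b := φ (0, 1)
  have hn : 0 < a ^ 2 + b ^ 2 := linearMap_prod_ne_zero hφ
  obtain ⟨K₁, hK₁, H₁⟩ := exists_ray_bound (u₁ := u₁) (u₂ := u₂) hρ (-b, a)
  obtain ⟨K₂, hK₂, H₂⟩ := exists_ray_bound (u₁ := u₁) (u₂ := u₂) hρ (b, -a)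
  set z := expVal2 u₁ u₂ ρ with hz
  refine mapsOpenAt_of_cone hρ ((K₁ + K₂) * ((|a| + |b|) / (a ^ 2 + b ^ 2))) fun w hw => ?_
  rw [← hz]
  have hwC := jointNR_subset u₁ u₂ hw
  have hφw : a * (w.1 - z.1) + b * (w.2 - z.2) = 0 := by
    obtain ⟨σ, hσ, rfl⟩ := hwC
    have := h σ hσ
    rw [linearMap_prod_apply, linearMap_prod_apply φ z] at this
    linarith
  obtain ⟨s, hs⟩ : ∃ s, s = (a * (w.2 - z.2) - b * (w.1 - z.1)) / (a ^ 2 + b ^ 2) := ⟨_, rfl⟩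
  have hs' : s * (a ^ 2 + b ^ 2) = a * (w.2 - z.2) - b * (w.1 - z.1) := by
    rw [hs]; field_simp
  have hsv : w - z = s • (-b, a) := by
    ext
    · refine mul_right_cancel₀ hn.ne' ?_
      simp only [Prod.fst_sub, Prod.smul_mk, smul_eq_mul]
      linear_combination a * hφw + b * hs'
    · refine mul_right_cancel₀ hn.ne' ?_
      simp only [Prod.snd_sub, Prod.smul_mk, smul_eq_mul]
      linear_combination b * hφw - a * hs'
  have hsb : |s| ≤ (|a| + |b|) / (a ^ 2 + b ^ 2) * ‖w - z‖ := by
    have e1 : |w.1 - z.1| ≤ ‖w - z‖ := norm_fst_le (w - z)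
    have e2 : |w.2 - z.2| ≤ ‖w - z‖ := norm_snd_le (w - z)
    rw [hs, abs_div, abs_of_pos hn, div_mul_eq_mul_div]
    gcongr
    calc |a * (w.2 - z.2) - b * (w.1 - z.1)| ≤ |a * (w.2 - z.2)| + |b * (w.1 - z.1)| := abs_sub _ _
      _ ≤ _ := by
        rw [abs_mul, abs_mul, add_mul]
        gcongr
  rcases le_total 0 s with h0 | h0
  · obtain ⟨σ, hσ, t, ht0, ht, he⟩ := H₁ s h0 (by rwa [← hsv, add_sub_cancel])
    refine ⟨σ, hσ, ρ, hρ, t, 0, ht0, le_rfl, ?_, by rw [hsv, he]; simp⟩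
    rw [abs_of_nonneg h0] at hsb
    nlinarith [mul_nonneg hK₂ h0, mul_le_mul_of_nonneg_left hsb (add_nonneg hK₁ hK₂)]
  · have e : s • (-b, a) = (-s) • (b, -a) := by ext <;> simp
    obtain ⟨σ, hσ, t, ht0, ht, he⟩ := H₂ (-s) (by linarith) (by rwa [← e, ← hsv, add_sub_cancel])
    refine ⟨σ, hσ, ρ, hρ, t, 0, ht0, le_rfl, ?_, by rw [hsv, e, he]; simp⟩
    rw [abs_of_nonpos h0] at hsb
    nlinarith [mul_nonneg hK₁ (neg_nonneg.2 h0),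
      mul_le_mul_of_nonneg_left hsb (add_nonneg hK₁ hK₂)]

lemma mapsOpenAt_of_mem_interior (hρ : ρ ∈ stateSpace d)
    (h : expVal2 u₁ u₂ ρ ∈ interior (expVal2 u₁ u₂ '' stateSpace d)) :
    MapsOpenAt (expVal2 u₁ u₂) (stateSpace d) (jointNR u₁ u₂) ρ := by
  obtain ⟨ε, hε, hball⟩ := Metric.mem_nhds_iff.1 (mem_interior_iff_mem_nhds.1 h)
  set z := expVal2 u₁ u₂ ρ with hz
  refine mapsOpenAt_of_cone hρ (2 / ε) fun w hw => ?_
  rw [← hz]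
  rcases eq_or_ne w z with rfl | hne
  · exact ⟨ρ, hρ, ρ, hρ, 0, 0, le_rfl, le_rfl, by simp, by simp⟩
  have hn : 0 < ‖w - z‖ := norm_pos_iff.2 (sub_ne_zero.2 hne)
  obtain ⟨σ, hσ, he⟩ := @hball (z + (ε / (2 * ‖w - z‖)) • (w - z)) (by
    rw [mem_ball_iff_norm, add_sub_cancel_left, norm_smul, Real.norm_of_nonneg (by positivity)]
    have : ε / (2 * ‖w - z‖) * ‖w - z‖ = ε / 2 := by field_simp
    linarith)
  refine ⟨σ, hσ, ρ, hρ, 2 / ε * ‖w - z‖, 0, by positivity, le_rfl, by simp, ?_⟩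
  rw [he, add_sub_cancel_left, smul_smul]
  have : 2 / ε * ‖w - z‖ * (ε / (2 * ‖w - z‖)) = 1 := by field_simp
  simp [this]

end Support

section NormalForm

lemma eq_single_of_re_diag_eq_zero {d : ℕ} {ρ : Matrix (Fin d) (Fin d) ℂ} (hρ : ρ ∈ stateSpace d)
    {k : Fin d} (h : ∀ i, i ≠ k → (ρ i i).re = 0) : ρ = Matrix.single k k 1 := by
  have h0 : ∀ i j, i ≠ k ∨ j ≠ k → ρ i j = 0 := by
    rintro i j (hi | hj)
    · exact (hρ.1.apply_eq_zero (h i hi) j).1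
    · exact (hρ.1.apply_eq_zero (h j hj) i).2
  have h1 : ρ k k = 1 := by
    have := hρ.2
    change ∑ i, ρ i i = 1 at this
    rwa [Finset.sum_eq_single k (fun i _ hi => h0 i i (Or.inl hi)) (by simp)] at this
  ext i j
  by_cases hi : i = k
  · by_cases hj : j = k
    · subst hi; subst hj; simpa using h1
    · rw [h0 i j (Or.inr hj), Matrix.single_apply_of_ne]; tauto
  · rw [h0 i j (Or.inl hi), Matrix.single_apply_of_ne]; tauto

lemma eq_of_conj_eq {d : ℕ} {U ρ σ : Matrix (Fin d) (Fin d) ℂ}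
    (hU : U ∈ Matrix.unitaryGroup (Fin d) ℂ) (h : star U * ρ * U = star U * σ * U) : ρ = σ := by
  have hh := Matrix.mem_unitaryGroup_iff.1 hU
  have key : ∀ τ, U * (star U * τ * U) * star U = τ := fun τ => by
    calc _ = (U * star U) * τ * (U * star U) := by simp only [mul_assoc]
      _ = τ := by rw [hh, one_mul, mul_one]
  rw [← key ρ, h, key σ]

lemma star_mul_mul_mul_eq {d : ℕ} (U V A : Matrix (Fin d) (Fin d) ℂ) :
    star (U * V) * A * (U * V) = star V * (star U * A * U) * V := by
  rw [star_mul]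
  simp only [mul_assoc]

lemma exists_unitary_conj_eq_diagonal {d : ℕ} {A : Matrix (Fin d) (Fin d) ℂ}
    (hA : A.IsHermitian) : ∃ U ∈ Matrix.unitaryGroup (Fin d) ℂ,
      star U * A * U = Matrix.diagonal fun i => (hA.eigenvalues i : ℂ) :=
  ⟨hA.eigenvectorUnitary, hA.eigenvectorUnitary.2, by
    have := hA.conjStarAlgAut_star_eigenvectorUnitary
    rw [Unitary.conjStarAlgAut_star_apply] at this
    exact this⟩

lemma exists_conj_eq_diagonal_of_two_states {P ρ σ : Matrix (Fin 3) (Fin 3) ℂ}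
    (hP : P.PosSemidef) (hP0 : P ≠ 0) (hρ : ρ ∈ stateSpace 3) (hσ : σ ∈ stateSpace 3)
    (hne : σ ≠ ρ) (hPρ : (P * ρ).trace.re = 0) (hPσ : (P * σ).trace.re = 0) :
    ∃ U ∈ Matrix.unitaryGroup (Fin 3) ℂ, ∃ l : ℝ, 0 < l ∧
      star U * P * U = Matrix.diagonal ![0, 0, (l : ℂ)] := by
  obtain ⟨V, hV, hVP⟩ := exists_unitary_conj_eq_diagonal hP.isHermitian
  set μ := hP.isHermitian.eigenvalues with hμ
  have hμ0 : ∀ i, 0 ≤ μ i := hP.eigenvalues_nonneg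
  obtain ⟨k, hk⟩ : ∃ k, 0 < μ k := by
    by_contra! hn
    refine hP0 (eq_of_conj_eq hV ?_)
    rw [hVP]
    have : (fun i => (μ i : ℂ)) = 0 := funext fun i => by
      simp [le_antisymm (hn i) (hμ0 i)]
    rw [this]
    simp
  set s : Equiv.Perm (Fin 3) := Equiv.swap k 2 with hs
  set T : Matrix (Fin 3) (Fin 3) ℂ := s.permMatrix ℂ with hT
  have hTs : star T = (s⁻¹).permMatrix ℂ := by
    rw [hT, Matrix.star_eq_conjTranspose, Matrix.conjTranspose_permMatrix]
  have hTu : T ∈ Matrix.unitaryGroup (Fin 3) ℂ := by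
    rw [Matrix.mem_unitaryGroup_iff, hTs, hT, ← Matrix.permMatrix_mul]
    simp
  have hW : V * T ∈ Matrix.unitaryGroup (Fin 3) ℂ := mul_mem hV hTu
  have hD : star (V * T) * P * (V * T) = Matrix.diagonal fun i => (μ (s i) : ℂ) := by
    rw [star_mul_mul_mul_eq, hVP, hTs, hT, Equiv.Perm.permMatrix, Equiv.Perm.permMatrix,
      PEquiv.toMatrix_toPEquiv_mul, PEquiv.mul_toMatrix_toPEquiv]
    ext i j
    simp [Matrix.diagonal_apply, hs]
  have key : ∀ τ ∈ stateSpace 3, (P * τ).trace.re = 0 → ∀ i, 0 < μ (s i) →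
      ((star (V * T) * τ * (V * T)) i i).re = 0 := by
    intro τ hτ h0 i hi
    rw [← trace_conj_mul_conj hW, hD] at h0
    have hτ' := conj_mem_stateSpace hW hτ
    set τ' := star (V * T) * τ * (V * T)
    simp only [Matrix.trace, Matrix.diag_apply, Matrix.diagonal_mul, Complex.re_sum,
      Complex.re_ofReal_mul] at h0
    have := (Finset.sum_eq_zero_iff_of_nonneg fun j _ =>
      mul_nonneg (hμ0 (s j)) (hτ'.1.re_diag_nonneg j)).1 h0 i (Finset.mem_univ i)
    exact (mul_eq_zero.1 this).resolve_left hi.ne'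
  have h2 : 0 < μ (s 2) := by simpa [hs] using hk
  have uniq : ∀ m : Fin 3, (∀ i, i ≠ m → 0 < μ (s i)) → False := fun m hm => by
    refine hne (eq_of_conj_eq hW ?_)
    rw [eq_single_of_re_diag_eq_zero (conj_mem_stateSpace hW hρ)
        fun i hi => key ρ hρ hPρ i (hm i hi),
      eq_single_of_re_diag_eq_zero (conj_mem_stateSpace hW hσ)
        fun i hi => key σ hσ hPσ i (hm i hi)]
  have e0 : μ (s 0) = 0 := by
    by_contra h
    have h' := (hμ0 (s 0)).lt_of_ne' h
    exact uniq 1 fun i hi => by fin_cases i <;> first | exact h' | exact h2 | exact (hi rfl).elim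
  have e1 : μ (s 1) = 0 := by
    by_contra h
    have h' := (hμ0 (s 1)).lt_of_ne' h
    exact uniq 0 fun i hi => by fin_cases i <;> first | exact h' | exact h2 | exact (hi rfl).elim
  refine ⟨V * T, hW, μ (s 2), h2, ?_⟩
  rw [hD]
  congr 1
  ext i
  fin_cases i <;> simp [e0, e1]

lemma exists_conj_offDiag_eq_zero {Q : Matrix (Fin 3) (Fin 3) ℂ} (hQ : Q.IsHermitian) :
    ∃ V ∈ Matrix.unitaryGroup (Fin 3) ℂ,
      (∀ l : ℂ, star V * Matrix.diagonal ![0, 0, l] * V = Matrix.diagonal ![0, 0, l]) ∧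
      (star V * Q * V) 0 1 = 0 := by
  obtain ⟨W, hW, hWQ⟩ := exists_unitary_conj_eq_diagonal (hQ.submatrix (Fin.castSucc (n := 2)))
  have hW1 := Matrix.mem_unitaryGroup_iff'.1 hW
  have hentry := congrFun (congrFun hWQ 0) 1
  have h00 := congrFun (congrFun hW1 0) 0
  have h01 := congrFun (congrFun hW1 0) 1
  have h10 := congrFun (congrFun hW1 1) 0
  have h11 := congrFun (congrFun hW1 1) 1
  simp [Matrix.mul_apply, Fin.sum_univ_two, Matrix.star_apply] at h00 h01 h10 h11 hentry
  refine ⟨!![W 0 0, W 0 1, 0; W 1 0, W 1 1, 0; 0, 0, 1], ?_, fun l => ?_, ?_⟩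
  · rw [Matrix.mem_unitaryGroup_iff']
    ext i j
    fin_cases i <;> fin_cases j <;>
      simp [Matrix.mul_apply, Fin.sum_univ_three, Matrix.star_apply, h00, h01, h10, h11]
  · ext i j
    fin_cases i <;> fin_cases j <;>
      simp [Matrix.mul_apply, Fin.sum_univ_three, Matrix.star_apply, Matrix.diagonal_apply]
  · simp [Matrix.mul_apply, Fin.sum_univ_three, Matrix.star_apply]
    exact hentry

lemma exists_conj_normal_form {Q : Matrix (Fin 3) (Fin 3) ℂ} (hQ : Q.IsHermitian)
    (h00 : Q 0 0 = 0) (h11 : Q 1 1 = 0) (h01 : Q 0 1 = 0) (hne : Q 0 2 ≠ 0 ∨ Q 1 2 ≠ 0) :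
    ∃ V ∈ Matrix.unitaryGroup (Fin 3) ℂ, ∃ k : ℂ, k ≠ 0 ∧
      (∀ l : ℂ, star V * Matrix.diagonal ![0, 0, l] * V = !![0, 0, 0; 0, l, 0; 0, 0, 0]) ∧
      star V * Q * V = !![0, k, 0; star k, Q 2 2, 0; 0, 0, 0] := by
  have h10 : Q 1 0 = 0 := by rw [← hQ.apply, h01, star_zero]
  have h20 : Q 2 0 = star (Q 0 2) := (hQ.apply _ _).symm
  have h21 : Q 2 1 = star (Q 1 2) := (hQ.apply _ _).symm
  generalize hx : Q 0 2 = x at *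
  generalize hy : Q 1 2 = y at *
  set m : ℝ := Complex.normSq x + Complex.normSq y with hm
  have hmpos : 0 < m := by
    rcases hne with h | h
    · exact add_pos_of_pos_of_nonneg (Complex.normSq_pos.2 h) (Complex.normSq_nonneg _)
    · exact add_pos_of_nonneg_of_pos (Complex.normSq_nonneg _) (Complex.normSq_pos.2 h)
  set r : ℝ := Real.sqrt m with hr
  have hr0 : (r : ℂ) ≠ 0 := by exact_mod_cast (Real.sqrt_pos.2 hmpos).ne'
  have hrr : (r : ℂ) ^ 2 = x * star x + y * star y := by
    rw [← Complex.ofReal_pow, hr, Real.sq_sqrt hmpos.le, hm]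
    push_cast
    rw [← Complex.mul_conj, ← Complex.mul_conj]
    rfl
  simp only [Complex.star_def] at hrr h20 h21
  refine ⟨!![x / r, 0, -star y / r; y / r, 0, star x / r; 0, 1, 0], ?_, r, hr0, fun l => ?_, ?_⟩
  · rw [Matrix.mem_unitaryGroup_iff']
    ext i j
    fin_cases i <;> fin_cases j <;>
      simp [Matrix.mul_apply, Fin.sum_univ_three, Matrix.star_apply] <;> field_simp <;>
      first | ring1 | linear_combination -hrr
  · ext i j
    fin_cases i <;> fin_cases j <;>
      simp [Matrix.mul_apply, Fin.sum_univ_three, Matrix.star_apply, Matrix.diagonal_apply]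
  · ext i j
    fin_cases i <;> fin_cases j <;>
      simp [Matrix.mul_apply, Fin.sum_univ_three, Matrix.star_apply, h00, h11, h01, h10, h20,
        h21, hx, hy] <;> field_simp <;>
      first | ring1 | linear_combination -hrr

end NormalForm

section Cone

variable {d : ℕ} {u₁ u₂ ρ : Matrix (Fin d) (Fin d) ℂ}

lemma sub_eq_of_gaps {a b p q : ℝ} {z w : ℝ × ℝ} (hn : 0 < a ^ 2 + b ^ 2)
    (hp : a * (z.1 - w.1) + b * (z.2 - w.2) = p) (hq : -b * (z.1 - w.1) + a * (z.2 - w.2) = q) :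
    w - z = ((b * q - a * p) / (a ^ 2 + b ^ 2), -(b * p + a * q) / (a ^ 2 + b ^ 2)) := by
  ext
  · simp only [Prod.fst_sub]
    rw [eq_div_iff hn.ne', ← hp, ← hq]
    ring
  · simp only [Prod.snd_sub]
    rw [eq_div_iff hn.ne', ← hp, ← hq]
    ring

lemma mapsOpenAt_of_flat (hρ : ρ ∈ stateSpace d) {z : ℝ × ℝ} (hz : expVal2 u₁ u₂ ρ = z)
    {a b : ℝ} (hn : 0 < a ^ 2 + b ^ 2)
    (hnn : ∀ τ ∈ stateSpace d, 0 ≤ (gapMatrix u₁ u₂ z a b * τ).trace.re)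
    {σ₁ σ₂ σ₃ : Matrix (Fin d) (Fin d) ℂ}
    (hσ₁ : σ₁ ∈ stateSpace d) (hσ₂ : σ₂ ∈ stateSpace d) (hσ₃ : σ₃ ∈ stateSpace d)
    (hp₁ : (gapMatrix u₁ u₂ z a b * σ₁).trace.re = 0)
    (hp₂ : (gapMatrix u₁ u₂ z a b * σ₂).trace.re = 0)
    (hp₃ : 0 < (gapMatrix u₁ u₂ z a b * σ₃).trace.re)
    (hq₁ : 0 < (gapMatrix u₁ u₂ z (-b) a * σ₁).trace.re)
    (hq₂ : (gapMatrix u₁ u₂ z (-b) a * σ₂).trace.re < 0) :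
    MapsOpenAt (expVal2 u₁ u₂) (stateSpace d) (jointNR u₁ u₂) ρ := by
  have gap : ∀ τ ∈ stateSpace d, expVal2 u₁ u₂ τ - z =
      ((b * (gapMatrix u₁ u₂ z (-b) a * τ).trace.re - a * (gapMatrix u₁ u₂ z a b * τ).trace.re)
        / (a ^ 2 + b ^ 2), -(b * (gapMatrix u₁ u₂ z a b * τ).trace.re +
          a * (gapMatrix u₁ u₂ z (-b) a * τ).trace.re) / (a ^ 2 + b ^ 2)) := fun τ hτ =>
    sub_eq_of_gaps hn (trace_gapMatrix_mul z a b hτ.2).symm (trace_gapMatrix_mul z (-b) a hτ.2).symm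
  have g₁ := gap σ₁ hσ₁
  have g₂ := gap σ₂ hσ₂
  have g₃ := gap σ₃ hσ₃
  rw [hp₁] at g₁
  rw [hp₂] at g₂
  generalize (gapMatrix u₁ u₂ z a b * σ₃).trace.re = l at *
  generalize (gapMatrix u₁ u₂ z (-b) a * σ₃).trace.re = c at *
  generalize (gapMatrix u₁ u₂ z (-b) a * σ₁).trace.re = m₁ at *
  generalize (gapMatrix u₁ u₂ z (-b) a * σ₂).trace.re = m₂ at *
  have hm₂ : 0 < -m₂ := by linarith
  refine mapsOpenAt_of_cone hρ
    ((|a| + |b|) * (l⁻¹ + (1 + |c| * l⁻¹) * (m₁⁻¹ + (-m₂)⁻¹))) fun w hw => ?_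
  rw [hz]
  obtain ⟨τ, hτ, rfl⟩ := jointNR_subset u₁ u₂ hw
  have gτ := gap τ hτ
  have hp0 := hnn τ hτ
  have tp := trace_gapMatrix_mul (u₁ := u₁) (u₂ := u₂) z a b hτ.2
  have tq := trace_gapMatrix_mul (u₁ := u₁) (u₂ := u₂) z (-b) a hτ.2
  generalize (gapMatrix u₁ u₂ z a b * τ).trace.re = p at *
  generalize (gapMatrix u₁ u₂ z (-b) a * τ).trace.re = q at *
  generalize expVal2 u₁ u₂ τ = w at *
  have e1 : |z.1 - w.1| ≤ ‖w - z‖ := by rw [abs_sub_comm]; exact norm_fst_le (w - z)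
  have e2 : |z.2 - w.2| ≤ ‖w - z‖ := by rw [abs_sub_comm]; exact norm_snd_le (w - z)
  have bp : |p| ≤ (|a| + |b|) * ‖w - z‖ := by
    rw [tp, add_mul]
    refine (abs_add_le _ _).trans ?_
    rw [abs_mul, abs_mul]
    gcongr
  have bq : |q| ≤ (|a| + |b|) * ‖w - z‖ := by
    rw [tq, add_mul, add_comm (|a| * _)]
    refine (abs_add_le _ _).trans ?_
    rw [abs_mul, abs_mul, abs_neg]
    gcongr
  set N := (|a| + |b|) * ‖w - z‖ with hN
  have hN0 : 0 ≤ N := by positivity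
  have bp' : p * l⁻¹ ≤ N * l⁻¹ :=
    mul_le_mul_of_nonneg_right ((le_abs_self p).trans bp) (by positivity)
  have br : |q - p * l⁻¹ * c| ≤ N * (1 + |c| * l⁻¹) := by
    refine (abs_sub _ _).trans ?_
    rw [abs_mul, abs_of_nonneg (by positivity : 0 ≤ p * l⁻¹)]
    nlinarith [mul_le_mul_of_nonneg_right bp' (abs_nonneg c)]
  have hK : (|a| + |b|) * (l⁻¹ + (1 + |c| * l⁻¹) * (m₁⁻¹ + (-m₂)⁻¹)) * ‖w - z‖ =
      N * l⁻¹ + N * (1 + |c| * l⁻¹) * m₁⁻¹ + N * (1 + |c| * l⁻¹) * (-m₂)⁻¹ := by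
    rw [hN]; ring
  have i₁ : 0 ≤ N * (1 + |c| * l⁻¹) * m₁⁻¹ := by positivity
  have i₂ : 0 ≤ N * (1 + |c| * l⁻¹) * (-m₂)⁻¹ := by positivity
  have combo : ∀ t m : ℝ, t * m = q - p * l⁻¹ * c →
      ((b * q - a * p) / (a ^ 2 + b ^ 2), -(b * p + a * q) / (a ^ 2 + b ^ 2)) =
      (p * l⁻¹) • ((b * c - a * l) / (a ^ 2 + b ^ 2), -(b * l + a * c) / (a ^ 2 + b ^ 2)) +
      t • ((b * m - a * 0) / (a ^ 2 + b ^ 2), -(b * 0 + a * m) / (a ^ 2 + b ^ 2)) := by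
    intro t m htm
    have hl : p * l⁻¹ * l = p := by field_simp
    ext
    · simp only [Prod.fst_add, Prod.smul_mk, smul_eq_mul]
      rw [mul_div_assoc', mul_div_assoc', ← add_div]
      congr 1
      linear_combination (-b) * htm + a * hl
    · simp only [Prod.snd_add, Prod.smul_mk, smul_eq_mul]
      rw [mul_div_assoc', mul_div_assoc', ← add_div]
      congr 1
      linear_combination a * htm + b * hl
  rw [hK, gτ]
  rcases le_total 0 (q - p * l⁻¹ * c) with h | h
  · refine ⟨σ₃, hσ₃, σ₁, hσ₁, p * l⁻¹, (q - p * l⁻¹ * c) * m₁⁻¹, by positivity,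
      by positivity, ?_, ?_⟩
    · rw [abs_of_nonneg h] at br
      have := mul_le_mul_of_nonneg_right br (inv_nonneg.2 hq₁.le)
      linarith
    · rw [g₃, g₁]
      exact combo _ _ (by field_simp)
  · refine ⟨σ₃, hσ₃, σ₂, hσ₂, p * l⁻¹, -(q - p * l⁻¹ * c) * (-m₂)⁻¹, by positivity,
      mul_nonneg (by linarith) (by positivity), ?_, ?_⟩
    · rw [abs_of_nonpos h] at br
      have := mul_le_mul_of_nonneg_right br (inv_nonneg.2 hm₂.le)
      linarith
    · rw [g₃, g₂]
      exact combo _ _ (by rw [inv_neg, neg_mul_neg, inv_mul_cancel_right₀ hq₂.ne])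

end Cone

section Conclusion

lemma not_unitarilyReducible_of_commutator_ne_zero {B : Matrix (Fin 2) (Fin 2) ℂ}
    (hB : B * star B ≠ star B * B) : ¬ UnitarilyReducible B := by
  rintro ⟨a, b, hab, ha, hb, V, hV, C, D, h⟩
  obtain rfl : a = 1 := by omega
  obtain rfl : b = 1 := by omega
  refine hB ?_
  have e01 : (star V * B * V) 0 1 = 0 := by
    rw [h]
    rfl
  have e10 : (star V * B * V) 1 0 = 0 := by
    rw [h]
    rfl
  have hstar : star (star V * B * V) = star V * star B * V := by
    simp only [star_mul, star_star, mul_assoc]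
  have hVV := Matrix.mem_unitaryGroup_iff.1 hV
  have hprod : ∀ X Y : Matrix (Fin 2) (Fin 2) ℂ,
      star V * (X * Y) * V = (star V * X * V) * (star V * Y * V) := fun X Y => by
    calc _ = star V * X * (V * star V) * Y * V := by
          rw [hVV]
          simp only [mul_assoc, mul_one]
      _ = _ := by simp only [mul_assoc]
  refine eq_of_conj_eq hV ?_
  rw [hprod, hprod, ← hstar]
  generalize star V * B * V = E at *
  ext i j
  fin_cases i <;> fin_cases j <;>
    simp [Matrix.mul_apply, Fin.sum_univ_two, Matrix.star_apply, e01, e10, mul_comm]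

variable {d : ℕ} {u₁ u₂ : Matrix (Fin d) (Fin d) ℂ}

lemma gapMatrix_combo (z : ℝ × ℝ) (a b s t : ℝ) :
    s • gapMatrix u₁ u₂ z a b + t • gapMatrix u₁ u₂ z (-b) a =
      gapMatrix u₁ u₂ z (s * a - t * b) (s * b + t * a) := by
  unfold gapMatrix
  module

lemma add_I_smul_eq {z : ℝ × ℝ} {a b : ℝ} (hn : 0 < a ^ 2 + b ^ 2) :
    u₁ + Complex.I • u₂ = ((z.1 : ℂ) + z.2 * Complex.I) • (1 : Matrix (Fin d) (Fin d) ℂ) +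
      (-((a : ℂ) + b * Complex.I) / ((a ^ 2 + b ^ 2 : ℝ) : ℂ)) •
        (gapMatrix u₁ u₂ z a b + Complex.I • gapMatrix u₁ u₂ z (-b) a) := by
  have hn' : ((a : ℂ) ^ 2 + (b : ℂ) ^ 2) ≠ 0 := by exact_mod_cast hn.ne'
  ext i j
  simp only [gapMatrix, Matrix.add_apply, Matrix.smul_apply, Matrix.sub_apply, smul_eq_mul,
    Complex.real_smul]
  push_cast
  field_simp
  linear_combination ((a : ℂ) * b * (z.2 * (1 : Matrix (Fin d) (Fin d) ℂ) i j - u₂ i j) -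
    b ^ 2 * (z.1 * (1 : Matrix (Fin d) (Fin d) ℂ) i j - u₁ i j)) * Complex.I_sq

lemma conj_dotProduct (U A : Matrix (Fin d) (Fin d) ℂ) (x : Fin d → ℂ) :
    star (U.mulVec x) ⬝ᵥ A.mulVec (U.mulVec x) = star x ⬝ᵥ (star U * A * U).mulVec x := by
  rw [Matrix.star_mulVec, Matrix.mulVec_mulVec, Matrix.dotProduct_mulVec, Matrix.vecMul_vecMul,
    ← Matrix.dotProduct_mulVec, Matrix.star_eq_conjTranspose, mul_assoc]

lemma expVal2_eq_of_gaps_eq_zero {z : ℝ × ℝ} {a b : ℝ} (hn : 0 < a ^ 2 + b ^ 2)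
    {τ : Matrix (Fin d) (Fin d) ℂ} (hτ : τ ∈ stateSpace d)
    (hp : (gapMatrix u₁ u₂ z a b * τ).trace.re = 0)
    (hq : (gapMatrix u₁ u₂ z (-b) a * τ).trace.re = 0) : expVal2 u₁ u₂ τ = z := by
  have := sub_eq_of_gaps hn ((trace_gapMatrix_mul z a b hτ.2).symm.trans hp)
    ((trace_gapMatrix_mul z (-b) a hτ.2).symm.trans hq)
  rw [← sub_eq_zero, this]
  ext <;> simp

end Conclusion

section QutritNormalForm

variable {u₁ u₂ U : Matrix (Fin 3) (Fin 3) ℂ} {z : ℝ × ℝ} {a b l c : ℝ} {k : ℂ}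

lemma multiplyGenerated_of_normalForm (hz : z ∈ jointNR u₁ u₂)
    (hU : U ∈ Matrix.unitaryGroup (Fin 3) ℂ) (hn : 0 < a ^ 2 + b ^ 2)
    (hP : star U * gapMatrix u₁ u₂ z a b * U = !![0, 0, 0; 0, (l : ℂ), 0; 0, 0, 0])
    (hQ : star U * gapMatrix u₁ u₂ z (-b) a * U = !![0, k, 0; star k, (c : ℂ), 0; 0, 0, 0]) :
    MultiplyGenerated u₁ u₂ z := by
  refine ⟨hz, fun hs => ?_⟩
  have hUU := Matrix.mem_unitaryGroup_iff'.1 hU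
  have unit : ∀ i, star (U.mulVec (Pi.single i 1)) ⬝ᵥ U.mulVec (Pi.single i 1) = 1 := fun i => by
    have := conj_dotProduct U 1 (Pi.single i 1)
    rw [Matrix.one_mulVec, mul_one, hUU, Matrix.one_mulVec] at this
    rw [this]
    simp
  have val : ∀ i, i ≠ 1 → ((star (U.mulVec (Pi.single i 1)) ⬝ᵥ
      u₁.mulVec (U.mulVec (Pi.single i 1))).re, (star (U.mulVec (Pi.single i 1)) ⬝ᵥ
      u₂.mulVec (U.mulVec (Pi.single i 1))).re) = z := fun i hi => by
    have h := expVal2_eq_of_gaps_eq_zero (u₁ := u₁) (u₂ := u₂) (z := z) hn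
      (pure_mem_stateSpace (unit i))
      (by
        rw [trace_mul_pure, conj_dotProduct, hP]
        fin_cases i <;> first | exact (hi rfl).elim | simp)
      (by
        rw [trace_mul_pure, conj_dotProduct, hQ]
        fin_cases i <;> first | exact (hi rfl).elim | simp)
    rw [← h]
    simp only [expVal2, trace_mul_pure]
  obtain ⟨r, hr⟩ := hs _ _ (unit 0) (unit 2) (val 0 (by decide)) (val 2 (by decide))
  have := congrArg (fun v => ((star U).mulVec v) 2) hr
  simp only [Matrix.mulVec_smul, Matrix.mulVec_mulVec, hUU, Matrix.one_mulVec] at this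
  simp at this

lemma exists_blockForm_of_normalForm
    (hU : U ∈ Matrix.unitaryGroup (Fin 3) ℂ) (hn : 0 < a ^ 2 + b ^ 2) (hl : 0 < l) (hk : k ≠ 0)
    (hP : star U * gapMatrix u₁ u₂ z a b * U = !![0, 0, 0; 0, (l : ℂ), 0; 0, 0, 0])
    (hQ : star U * gapMatrix u₁ u₂ z (-b) a * U = !![0, k, 0; star k, (c : ℂ), 0; 0, 0, 0]) :
    ∃ U ∈ Matrix.unitaryGroup (Fin 3) ℂ, ∃ B : Matrix (Fin 2) (Fin 2) ℂ,
      ¬ UnitarilyReducible B ∧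
      star U * (u₁ + Complex.I • u₂) * U =
        Matrix.reindex (finSumFinEquiv (m := 2) (n := 1)) (finSumFinEquiv (m := 2) (n := 1))
          (Matrix.fromBlocks B 0 0 !![(z.1 : ℂ) + z.2 * Complex.I]) := by
  set ζ : ℂ := (z.1 : ℂ) + z.2 * Complex.I with hζ
  set w : ℂ := -((a : ℂ) + b * Complex.I) / ((a ^ 2 + b ^ 2 : ℝ) : ℂ) with hw
  have hw0 : w ≠ 0 := by
    refine div_ne_zero (neg_ne_zero.2 fun h => ?_) (by exact_mod_cast hn.ne')
    have h1 : a = 0 := by simpa using congrArg Complex.re h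
    have h2 : b = 0 := by simpa using congrArg Complex.im h
    simp [h1, h2] at hn
  refine ⟨U, hU, !![ζ, w * (Complex.I * k); w * (Complex.I * star k),
    ζ + w * (l + Complex.I * c)], not_unitarilyReducible_of_commutator_ne_zero fun h => ?_, ?_⟩
  · have h01 := congrFun (congrFun h 0) 1
    simp [Matrix.mul_apply, Fin.sum_univ_two, Matrix.star_apply] at h01
    have : 2 * Complex.I * k * w * (starRingEnd ℂ) w * l = 0 := by linear_combination h01
    have hl' : (l : ℂ) ≠ 0 := by exact_mod_cast hl.ne'
    simp [hk, hw0, hl'] at this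
  · have e : star U * (u₁ + Complex.I • u₂) * U =
        ζ • (1 : Matrix (Fin 3) (Fin 3) ℂ) + w • (!![0, 0, 0; 0, (l : ℂ), 0; 0, 0, 0] +
          Complex.I • !![0, k, 0; star k, (c : ℂ), 0; 0, 0, 0]) := by
      rw [add_I_smul_eq (z := z) hn, ← hP, ← hQ, ← hζ, ← hw]
      simp only [mul_add, add_mul, Matrix.mul_smul, Matrix.smul_mul, mul_one,
        Matrix.mem_unitaryGroup_iff'.1 hU]
    rw [e]
    have i0 : (finSumFinEquiv (m := 2) (n := 1)).symm 0 = Sum.inl 0 := rfl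
    have i1 : (finSumFinEquiv (m := 2) (n := 1)).symm 1 = Sum.inl 1 := rfl
    have i2 : (finSumFinEquiv (m := 2) (n := 1)).symm 2 = Sum.inr 0 := rfl
    ext i j
    fin_cases i <;> fin_cases j <;> simp [i0, i1, i2]

lemma isRoundBoundaryPoint_of_normalForm (h₁ : u₁.IsHermitian) (h₂ : u₂.IsHermitian)
    (hz : z ∈ frontier (jointNR u₁ u₂))
    (hU : U ∈ Matrix.unitaryGroup (Fin 3) ℂ) (hn : 0 < a ^ 2 + b ^ 2) (hl : 0 < l) (hk : k ≠ 0)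
    (hP : star U * gapMatrix u₁ u₂ z a b * U = !![0, 0, 0; 0, (l : ℂ), 0; 0, 0, 0])
    (hQ : star U * gapMatrix u₁ u₂ z (-b) a * U = !![0, k, 0; star k, (c : ℂ), 0; 0, 0, 0]) :
    IsRoundBoundaryPoint (jointNR u₁ u₂) z := by
  refine ⟨hz, ?_, ?_⟩
  · rintro ⟨-, l₁, l₂, hne, hl₁, hl₂⟩
    have key : ∀ L, IsSupportingLineAt (jointNR u₁ u₂) z L →
        L = {q | a * (q.1 - z.1) + b * (q.2 - z.2) = 0} := by
      rintro L ⟨φ, r, hφ, rfl, rfl, hsup⟩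
      have hM := (gapMatrix_posSemidef h₁ h₂ hsup).conjTranspose_mul_mul_same U
      have hφn := linearMap_prod_ne_zero hφ
      have eφ : ∀ q, φ q - φ z = φ (1, 0) * (q.1 - z.1) + φ (0, 1) * (q.2 - z.2) := fun q => by
        rw [linearMap_prod_apply φ q, linearMap_prod_apply φ z]
        ring
      generalize φ (1, 0) = x at *
      generalize φ (0, 1) = y at *
      set s := (x * a + y * b) / (a ^ 2 + b ^ 2) with hs
      set t := (y * a - x * b) / (a ^ 2 + b ^ 2) with ht
      have hx : x = s * a - t * b := by rw [hs, ht]; field_simp; ring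
      have hy : y = s * b + t * a := by rw [hs, ht]; field_simp; ring
      rw [hx, hy, ← gapMatrix_combo, ← Matrix.star_eq_conjTranspose] at hM
      simp only [mul_add, add_mul, Matrix.mul_smul, Matrix.smul_mul, hP, hQ] at hM
      have h01 := (hM.apply_eq_zero (i := 0) (by simp) 1).1
      have ht0 : t = 0 := by simpa [hk] using h01
      rw [ht0] at hx hy
      have hs0 : s ≠ 0 := by
        rintro h0
        rw [hx, hy, h0] at hφn
        simp at hφn
      ext q
      simp only [Set.mem_ofPred_eq]
      rw [← sub_eq_zero, eφ, hx, hy,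
        show (s * a - 0 * b) * (q.1 - z.1) + (s * b + 0 * a) * (q.2 - z.2) =
          s * (a * (q.1 - z.1) + b * (q.2 - z.2)) by ring, mul_eq_zero]
      simp [hs0]
    exact hne ((key l₁ hl₁).trans (key l₂ hl₂).symm)
  · rintro ⟨p, q, hpq, hseg, s, t, hs, ht, hst, hzpq⟩
    have hcl : closure (jointNR u₁ u₂) ⊆ expVal2 u₁ u₂ '' stateSpace 3 :=
      closure_minimal (jointNR_subset u₁ u₂)
        ((isCompact_stateSpace 3).image (continuous_expVal2 u₁ u₂)).isClosed
    obtain ⟨σ, hσ, rfl⟩ := hcl (frontier_subset_closure (hseg (left_mem_segment ℝ p q)))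
    obtain ⟨τ, hτ, rfl⟩ := hcl (frontier_subset_closure (hseg (right_mem_segment ℝ _ q)))
    have tr : ∀ ω ∈ stateSpace 3, (gapMatrix u₁ u₂ z a b * ω).trace.re =
        l * ((star U * ω * U) 1 1).re := fun ω _ => by
      rw [← trace_conj_mul_conj hU, hP]
      generalize star U * ω * U = X
      simp [Matrix.trace, Matrix.vecMul, dotProduct, Fin.sum_univ_three]
    have nn : ∀ ω ∈ stateSpace 3, 0 ≤ (gapMatrix u₁ u₂ z a b * ω).trace.re := fun ω hω => by
      rw [tr ω hω]
      exact mul_nonneg hl.le ((conj_mem_stateSpace hU hω).1.re_diag_nonneg 1)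
    have face : ∀ ω ∈ stateSpace 3, (gapMatrix u₁ u₂ z a b * ω).trace.re = 0 →
        expVal2 u₁ u₂ ω = z := fun ω hω h0 => by
      refine expVal2_eq_of_gaps_eq_zero hn hω h0 ?_
      rw [tr ω hω] at h0
      have hz := (conj_mem_stateSpace hU hω).1.apply_eq_zero
        ((mul_eq_zero.1 h0).resolve_left hl.ne')
      rw [← trace_conj_mul_conj hU, hQ]
      generalize star U * ω * U = X at hz ⊢
      simp [Matrix.trace, Matrix.vecMul, dotProduct, Fin.sum_univ_three, (hz 0).1, (hz 0).2,
        (hz 1).1]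
    have nσ := nn σ hσ
    have nτ := nn τ hτ
    have tσ := trace_gapMatrix_mul (u₁ := u₁) (u₂ := u₂) z a b hσ.2
    have tτ := trace_gapMatrix_mul (u₁ := u₁) (u₂ := u₂) z a b hτ.2
    have hz1 : s * (expVal2 u₁ u₂ σ).1 + t * (expVal2 u₁ u₂ τ).1 = z.1 := by
      simpa using congrArg Prod.fst hzpq
    have hz2 : s * (expVal2 u₁ u₂ σ).2 + t * (expVal2 u₁ u₂ τ).2 = z.2 := by
      simpa using congrArg Prod.snd hzpq
    have hsum : s * (gapMatrix u₁ u₂ z a b * σ).trace.re +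
        t * (gapMatrix u₁ u₂ z a b * τ).trace.re = 0 := by
      rw [tσ, tτ]
      linear_combination (a * z.1 + b * z.2) * hst - a * hz1 - b * hz2
    have mσ := mul_nonneg hs.le nσ
    have mτ := mul_nonneg ht.le nτ
    have zσ := (mul_eq_zero.1 (by linarith : s * (gapMatrix u₁ u₂ z a b * σ).trace.re = 0)
      ).resolve_left hs.ne'
    have zτ := (mul_eq_zero.1 (by linarith : t * (gapMatrix u₁ u₂ z a b * τ).trace.re = 0)
      ).resolve_left ht.ne'
    exact hpq ((face σ hσ zσ).trans (face τ hτ zτ).symm)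

end QutritNormalForm

section QutritClassification

lemma mapsOpenAt_of_gapMatrix_eq_zero {d : ℕ} {u₁ u₂ ρ : Matrix (Fin d) (Fin d) ℂ}
    (hρ : ρ ∈ stateSpace d) {z : ℝ × ℝ} (hz : expVal2 u₁ u₂ ρ = z) {x y : ℝ}
    (hn : 0 < x ^ 2 + y ^ 2) (h0 : gapMatrix u₁ u₂ z x y = 0) :
    MapsOpenAt (expVal2 u₁ u₂) (stateSpace d) (jointNR u₁ u₂) ρ := by
  refine mapsOpenAt_of_image_subset_line hρ
    (φ := x • LinearMap.fst ℝ ℝ ℝ + y • LinearMap.snd ℝ ℝ ℝ) (fun h => ?_) fun σ hσ => ?_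
  · have hx := LinearMap.congr_fun h (1, 0)
    have hy := LinearMap.congr_fun h (0, 1)
    simp only [LinearMap.add_apply, LinearMap.smul_apply, LinearMap.fst_apply,
      LinearMap.snd_apply, smul_eq_mul, mul_one, mul_zero, add_zero, zero_add,
      LinearMap.zero_apply] at hx hy
    simp [hx, hy] at hn
  · have := trace_gapMatrix_mul (u₁ := u₁) (u₂ := u₂) z x y hσ.2
    rw [h0, zero_mul, Matrix.trace_zero, Complex.zero_re] at this
    rw [hz]
    simp only [LinearMap.add_apply, LinearMap.smul_apply, LinearMap.fst_apply,
      LinearMap.snd_apply, smul_eq_mul]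
    linarith

variable {u₁ u₂ ρ : Matrix (Fin 3) (Fin 3) ℂ} {z : ℝ × ℝ} {a b : ℝ}

lemma exists_conj_diagonal_of_not_mapsOpenAt (h₁ : u₁.IsHermitian) (h₂ : u₂.IsHermitian)
    (hρ : ρ ∈ stateSpace 3) (hz : expVal2 u₁ u₂ ρ = z)
    (hno : ¬ MapsOpenAt (expVal2 u₁ u₂) (stateSpace 3) (jointNR u₁ u₂) ρ)
    (hn : 0 < a ^ 2 + b ^ 2) (hP : (gapMatrix u₁ u₂ z a b).PosSemidef) :
    ∃ U ∈ Matrix.unitaryGroup (Fin 3) ℂ, ∃ l : ℝ, 0 < l ∧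
      star U * gapMatrix u₁ u₂ z a b * U = Matrix.diagonal ![0, 0, (l : ℂ)] ∧
      (star U * gapMatrix u₁ u₂ z (-b) a * U) 0 0 = 0 ∧
      (star U * gapMatrix u₁ u₂ z (-b) a * U) 1 1 = 0 ∧
      (star U * gapMatrix u₁ u₂ z (-b) a * U) 0 1 = 0 := by
  have hP0 : gapMatrix u₁ u₂ z a b ≠ 0 := fun h => hno (mapsOpenAt_of_gapMatrix_eq_zero hρ hz hn h)
  obtain ⟨σ, hσ, hσz, hne⟩ :
      ∃ σ ∈ stateSpace 3, expVal2 u₁ u₂ σ = z ∧ σ ≠ ρ := by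
    by_contra! h
    exact hno (mapsOpenAt_of_unique fun σ hσ e => h σ hσ (e.trans hz))
  have tr0 : ∀ τ ∈ stateSpace 3, expVal2 u₁ u₂ τ = z → ∀ x y,
      (gapMatrix u₁ u₂ z x y * τ).trace.re = 0 := fun τ hτ e x y => by
    rw [trace_gapMatrix_mul z x y hτ.2, e]
    ring
  obtain ⟨U, hU, l, hl, hUP⟩ := exists_conj_eq_diagonal_of_two_states hP hP0 hρ hσ hne
    (tr0 ρ hρ hz a b) (tr0 σ hσ hσz a b)
  have hherm : ∀ W : Matrix (Fin 3) (Fin 3) ℂ,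
      (star W * gapMatrix u₁ u₂ z (-b) a * W).IsHermitian := fun W =>
    Matrix.isHermitian_conjTranspose_mul_mul W (gapMatrix_isHermitian h₁ h₂ z (-b) a)
  obtain ⟨V, hV, hVl, hV01⟩ := exists_conj_offDiag_eq_zero (hherm U)
  have hW : U * V ∈ Matrix.unitaryGroup (Fin 3) ℂ := mul_mem hU hV
  have hWP : star (U * V) * gapMatrix u₁ u₂ z a b * (U * V) =
      Matrix.diagonal ![0, 0, (l : ℂ)] := by
    rw [star_mul_mul_mul_eq, hUP, hVl]
  rw [← star_mul_mul_mul_eq] at hV01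
  have hWQ := hherm (U * V)
  generalize hWdef : U * V = W at *
  set Q := star W * gapMatrix u₁ u₂ z (-b) a * W with hQ
  have trP : ∀ τ, (gapMatrix u₁ u₂ z a b * τ).trace.re = l * ((star W * τ * W) 2 2).re :=
    fun τ => by
    rw [← trace_conj_mul_conj hW, hWP]
    generalize star W * τ * W = X
    simp [Matrix.trace, Fin.sum_univ_three, Matrix.diagonal_mul]
  have hV10 : Q 1 0 = 0 := by rw [← hWQ.apply, hV01, star_zero]
  have real : ∀ i, Q i i = ((Q i i).re : ℂ) := fun i =>
    (Complex.conj_eq_iff_re.1 (hWQ.apply i i)).symm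
  have fib : ∀ τ ∈ stateSpace 3, expVal2 u₁ u₂ τ = z → ((star W * τ * W) 2 2).re = 0 ∧
      (Q 0 0).re * ((star W * τ * W) 0 0).re + (Q 1 1).re * ((star W * τ * W) 1 1).re = 0 := by
    intro τ hτ e
    have h22 := (mul_eq_zero.1 ((trP τ).symm.trans (tr0 τ hτ e a b))).resolve_left hl.ne'
    refine ⟨h22, ?_⟩
    have hz := (conj_mem_stateSpace hW hτ).1.apply_eq_zero h22
    have hq := tr0 τ hτ e (-b) a
    rw [← trace_conj_mul_conj hW, ← hQ] at hq
    generalize star W * τ * W = X at hz ⊢ hq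
    simp only [Matrix.trace, Fin.sum_univ_three, Matrix.diag_apply, Matrix.mul_apply, hV01, hV10,
      (hz 0).1, (hz 0).2, (hz 1).1, (hz 1).2, (hz 2).1] at hq
    rw [real 0, real 1] at hq
    simpa using hq
  have uniq : ∀ m : Fin 3, (∀ τ ∈ stateSpace 3, expVal2 u₁ u₂ τ = z →
      ∀ i, i ≠ m → ((star W * τ * W) i i).re = 0) → False := fun m hm => by
    refine hne (eq_of_conj_eq hW ?_)
    rw [eq_single_of_re_diag_eq_zero (conj_mem_stateSpace hW hρ) (hm ρ hρ hz),
      eq_single_of_re_diag_eq_zero (conj_mem_stateSpace hW hσ) (hm σ hσ hσz)]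
  have pure : ∀ i, ∃ τ ∈ stateSpace 3, star W * τ * W = Matrix.single i i 1 := fun i => by
    have hx : star (Pi.single i 1 : Fin 3 → ℂ) ⬝ᵥ Pi.single i 1 = 1 := by simp
    refine ⟨_, conj_mem_stateSpace (Unitary.star_mem hW) (pure_mem_stateSpace hx), ?_⟩
    rw [← star_mul_mul_mul_eq, Matrix.mem_unitaryGroup_iff'.1 hW]
    ext p q
    simp [Matrix.vecMulVec_apply, Matrix.single_apply, Pi.single_apply]
    grind
  have trQ : ∀ τ i, star W * τ * W = Matrix.single i i 1 →
      (gapMatrix u₁ u₂ z (-b) a * τ).trace.re = (Q i i).re := fun τ i hi => by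
    rw [← trace_conj_mul_conj hW, hi, ← hQ, Matrix.trace_mul_single]
    simp
  have mixed : 0 ≤ (Q 0 0).re * (Q 1 1).re := by
    by_contra! hlt
    obtain ⟨σ₀, hσ₀, e₀⟩ := pure 0
    obtain ⟨σ₁, hσ₁, e₁⟩ := pure 1
    obtain ⟨σ₂, hσ₂, e₂⟩ := pure 2
    have nn : ∀ τ ∈ stateSpace 3, 0 ≤ (gapMatrix u₁ u₂ z a b * τ).trace.re := fun τ hτ => by
      rw [trP τ]
      exact mul_nonneg hl.le ((conj_mem_stateSpace hW hτ).1.re_diag_nonneg 2)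
    have p₀ : (gapMatrix u₁ u₂ z a b * σ₀).trace.re = 0 := by rw [trP, e₀]; simp
    have p₁ : (gapMatrix u₁ u₂ z a b * σ₁).trace.re = 0 := by rw [trP, e₁]; simp
    have p₂ : 0 < (gapMatrix u₁ u₂ z a b * σ₂).trace.re := by rw [trP, e₂]; simpa using hl
    rcases mul_neg_iff.1 hlt with ⟨h0, h1⟩ | ⟨h0, h1⟩
    · exact hno (mapsOpenAt_of_flat hρ hz hn nn hσ₀ hσ₁ hσ₂ p₀ p₁ p₂
        (by rwa [trQ _ _ e₀]) (by rwa [trQ _ _ e₁]))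
    · exact hno (mapsOpenAt_of_flat hρ hz hn nn hσ₁ hσ₀ hσ₂ p₁ p₀ p₂
        (by rwa [trQ _ _ e₁]) (by rwa [trQ _ _ e₀]))
  have nonneg : ∀ τ ∈ stateSpace 3, ∀ i, 0 ≤ ((star W * τ * W) i i).re := fun τ hτ =>
    (conj_mem_stateSpace hW hτ).1.re_diag_nonneg
  have zero : ∀ p q x y : ℝ, p ≠ 0 → 0 ≤ p * q → 0 ≤ x → 0 ≤ y → p * x + q * y = 0 → x = 0 := by
    intro p q x y hp hpq hx hy h
    have h1 : p ^ 2 * x + p * q * y = 0 := by linear_combination p * h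
    have h2 : 0 < p ^ 2 := by positivity
    have h3 := mul_nonneg hpq hy
    have h4 := mul_nonneg h2.le hx
    exact (mul_eq_zero.1 (by linarith : p ^ 2 * x = 0)).resolve_left h2.ne'
  refine ⟨W, hW, l, hl, hWP, ?_, ?_, hV01⟩
  · rw [← hQ, real 0, Complex.ofReal_eq_zero]
    by_contra h
    refine uniq 1 fun τ hτ e i hi => ?_
    have hf := fib τ hτ e
    have h0 := zero _ _ _ _ h mixed (nonneg τ hτ 0) (nonneg τ hτ 1) hf.2
    fin_cases i
    exacts [h0, (hi rfl).elim, hf.1]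
  · rw [← hQ, real 1, Complex.ofReal_eq_zero]
    by_contra h
    refine uniq 0 fun τ hτ e i hi => ?_
    have hf := fib τ hτ e
    have h0 := zero _ _ _ _ h (by rwa [mul_comm]) (nonneg τ hτ 1) (nonneg τ hτ 0)
      (by rw [add_comm]; exact hf.2)
    fin_cases i
    exacts [(hi rfl).elim, h0, hf.1]

lemma exists_normalForm_of_not_mapsOpenAt (h₁ : u₁.IsHermitian) (h₂ : u₂.IsHermitian)
    (hρ : ρ ∈ stateSpace 3) (hz : expVal2 u₁ u₂ ρ = z)
    (hno : ¬ MapsOpenAt (expVal2 u₁ u₂) (stateSpace 3) (jointNR u₁ u₂) ρ)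
    (hn : 0 < a ^ 2 + b ^ 2) (hP : (gapMatrix u₁ u₂ z a b).PosSemidef) :
    ∃ U ∈ Matrix.unitaryGroup (Fin 3) ℂ, ∃ (l c : ℝ) (k : ℂ), 0 < l ∧ k ≠ 0 ∧
      star U * gapMatrix u₁ u₂ z a b * U = !![0, 0, 0; 0, (l : ℂ), 0; 0, 0, 0] ∧
      star U * gapMatrix u₁ u₂ z (-b) a * U = !![0, k, 0; star k, (c : ℂ), 0; 0, 0, 0] := by
  obtain ⟨U, hU, l, hl, hUP, h00, h11, h01⟩ :=
    exists_conj_diagonal_of_not_mapsOpenAt h₁ h₂ hρ hz hno hn hP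
  have hherm : (star U * gapMatrix u₁ u₂ z (-b) a * U).IsHermitian :=
    Matrix.isHermitian_conjTranspose_mul_mul U (gapMatrix_isHermitian h₁ h₂ z (-b) a)
  set Q := star U * gapMatrix u₁ u₂ z (-b) a * U with hQ
  have real : Q 2 2 = ((Q 2 2).re : ℂ) := (Complex.conj_eq_iff_re.1 (hherm.apply 2 2)).symm
  have hne : Q 0 2 ≠ 0 ∨ Q 1 2 ≠ 0 := by
    by_contra! h
    have h10 : Q 1 0 = 0 := by rw [← hherm.apply, h01, star_zero]
    have h20 : Q 2 0 = 0 := by rw [← hherm.apply, h.1, star_zero]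
    have h21 : Q 2 1 = 0 := by rw [← hherm.apply, h.2, star_zero]
    refine hno (mapsOpenAt_of_gapMatrix_eq_zero hρ hz (x := (Q 2 2).re * a - -l * b)
      (y := (Q 2 2).re * b + -l * a) ?_ ?_)
    · have : 0 < ((Q 2 2).re ^ 2 + l ^ 2) * (a ^ 2 + b ^ 2) := by positivity
      linarith
    · rw [← gapMatrix_combo]
      refine eq_of_conj_eq hU ?_
      rw [mul_add, add_mul, Matrix.mul_smul, Matrix.smul_mul, Matrix.mul_smul, Matrix.smul_mul,
        hUP, ← hQ, mul_zero, zero_mul]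
      ext i j
      fin_cases i <;> fin_cases j <;> simp [h00, h01, h11, h10, h20, h21, h.1, h.2]
      rw [real]
      simp
      ring
  obtain ⟨V, hV, k, hk, hVl, hVQ⟩ := exists_conj_normal_form hherm h00 h11 h01 hne
  refine ⟨U * V, mul_mem hU hV, l, (Q 2 2).re, k, hl, hk, ?_, ?_⟩
  · rw [star_mul_mul_mul_eq, hUP, hVl]
  · rw [star_mul_mul_mul_eq, ← hQ, hVQ, ← real]

end QutritClassification

theorem nonopen_implies_multiply_generated_round_and_reducible_form
    (u₁ u₂ : Matrix (Fin 3) (Fin 3) ℂ)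
    (h₁ : u₁.IsHermitian) (h₂ : u₂.IsHermitian)
    (z : ℝ × ℝ) (hz : z ∈ jointNR u₁ u₂)
    (hnotopen : ∃ ρ ∈ stateSpace 3, expVal2 u₁ u₂ ρ = z ∧
      ¬ MapsOpenAt (expVal2 u₁ u₂) (stateSpace 3) (jointNR u₁ u₂) ρ) :
    MultiplyGenerated u₁ u₂ z ∧
    IsRoundBoundaryPoint (jointNR u₁ u₂) z ∧
    z ∈ frontier (jointNR u₁ u₂) ∧
    ∃ U ∈ Matrix.unitaryGroup (Fin 3) ℂ, ∃ B : Matrix (Fin 2) (Fin 2) ℂ,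
      ¬ UnitarilyReducible B ∧
      star U * (u₁ + Complex.I • u₂) * U =
        Matrix.reindex (finSumFinEquiv (m := 2) (n := 1)) (finSumFinEquiv (m := 2) (n := 1))
          (Matrix.fromBlocks B 0 0 !![(z.1 : ℂ) + z.2 * Complex.I]) := by
  obtain ⟨ρ, hρ, hρz, hno⟩ := hnotopen
  have hint : z ∉ interior (expVal2 u₁ u₂ '' stateSpace 3) := fun h =>
    hno (mapsOpenAt_of_mem_interior hρ (hρz ▸ h))
  have hfr : z ∈ frontier (jointNR u₁ u₂) :=
    ⟨subset_closure hz, fun h => hint (interior_mono (jointNR_subset u₁ u₂) h)⟩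
  obtain ⟨φ, hφ, hsup⟩ := exists_support_of_notMem_interior (convex_expVal2_image u₁ u₂)
    (jointNR_subset u₁ u₂ hz) hint
  have hn := linearMap_prod_ne_zero hφ
  obtain ⟨U, hU, l, c, k, hl, hk, hUP, hUQ⟩ := exists_normalForm_of_not_mapsOpenAt h₁ h₂ hρ hρz
    hno hn (gapMatrix_posSemidef h₁ h₂ fun w hw => hsup w (jointNR_subset u₁ u₂ hw))
  exact ⟨multiplyGenerated_of_normalForm hz hU hn hUP hUQ,
    isRoundBoundaryPoint_of_normalForm h₁ h₂ hfr hU hn hl hk hUP hUQ, hfr,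
    exists_blockForm_of_normalForm hU hn hl hk hUP hUQ⟩
end

section
/- Let u_1, …, u_r ∈ M_d be hermitian and let 𝓐(u) be the star subalgebra of M_d generated by the identity matrix and u_1, …, u_r. Then L(u) = 𝔼(𝓜(𝓐(u))), i.e., every point of L(u) = 𝔼(𝓜_d) is the image under 𝔼 of a density matrix belonging to 𝓐(u). -/
open Set Filter Topology Matrix
open scoped ComplexOrder

/-- The expected value map for `r` observables. -/
noncomputable def expVal {d r : ℕ} (u : Fin r → Matrix (Fin d) (Fin d) ℂ)
    (ρ : Matrix (Fin d) (Fin d) ℂ) : Fin r → ℝ :=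
  fun i => ((u i) * ρ).trace.re

/-- A functional calculus value of a Hermitian matrix lies in every star subalgebra containing it. -/
theorem cfc_mem_of_isHermitian {d : ℕ} (S : StarSubalgebra ℂ (Matrix (Fin d) (Fin d) ℂ))
    {a : Matrix (Fin d) (Fin d) ℂ} (ha : a.IsHermitian) (haS : a ∈ S) (f : ℝ → ℝ) :
    cfc f a ∈ S := by
  have hfin : (spectrum ℝ a).Finite := Matrix.finite_real_spectrum
  have hp : (spectrum ℝ a).EqOn f
      (fun x => (Lagrange.interpolate hfin.toFinset id f).eval x) := by
    intro x hx
    exact (Lagrange.eval_interpolate_at_node f (Function.injective_id.injOn)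
      (hfin.mem_toFinset.2 hx)).symm
  rw [cfc_congr hp, cfc_polynomial _ a ha.isSelfAdjoint]
  rw [← Polynomial.aeval_subalgebra_coe _ (S.toSubalgebra.restrictScalars ℝ) ⟨a, haS⟩]
  exact Subtype.coe_prop _

/-- A matrix functional restricted to a star subalgebra is represented by an element of it. -/
theorem exists_mem_trace_mul_eq {d : ℕ} (S : StarSubalgebra ℂ (Matrix (Fin d) (Fin d) ℂ))
    (ρ : Matrix (Fin d) (Fin d) ℂ) :
    ∃ σ ∈ S, ∀ a ∈ S, (a * σ).trace = (a * ρ).trace := by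
  let B : Matrix (Fin d) (Fin d) ℂ →ₗ[ℂ] Module.Dual ℂ (Subalgebra.toSubmodule S.toSubalgebra) :=
    (Submodule.subtype _).dualMap ∘ₗ
      ((Matrix.traceLinearMap (Fin d) ℂ ℂ).compRight ℂ ∘ₗ
        (LinearMap.mul ℂ (Matrix (Fin d) (Fin d) ℂ)).flip)
  have hB (x) (a) : B x a = ((a : Matrix (Fin d) (Fin d) ℂ) * x).trace := rfl
  have hinj : Function.Injective (B ∘ₗ (Subalgebra.toSubmodule S.toSubalgebra).subtype) := by
    rw [injective_iff_map_eq_zero]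
    intro b hb
    have h := LinearMap.congr_fun hb ⟨star b.1, star_mem (s := S) b.2⟩
    exact Subtype.ext (Matrix.trace_conjTranspose_mul_self_eq_zero_iff.1 h)
  have hsurj := (LinearMap.injective_iff_surjective_of_finrank_eq_finrank
    (Subspace.dual_finrank_eq).symm).1 hinj
  obtain ⟨σ, hσ⟩ := hsurj (B ρ)
  exact ⟨σ.1, σ.2, fun a ha => LinearMap.congr_fun hσ ⟨a, ha⟩⟩

/-- An element of a star subalgebra that represents a positive functional is positive. -/
theorem posSemidef_of_trace_mul_eq {d : ℕ} (S : StarSubalgebra ℂ (Matrix (Fin d) (Fin d) ℂ))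
    {ρ σ : Matrix (Fin d) (Fin d) ℂ} (hρ : ρ.PosSemidef) (hσ : σ ∈ S)
    (h : ∀ a ∈ S, (a * σ).trace = (a * ρ).trace) : σ.PosSemidef := by
  have hstar (a) (ha : a ∈ S) : (a * σᴴ).trace = (a * ρ).trace := by
    have h1 := congrArg star (h _ (star_mem ha))
    rw [← Matrix.trace_conjTranspose, ← Matrix.trace_conjTranspose, star_eq_conjTranspose,
      Matrix.conjTranspose_mul, Matrix.conjTranspose_mul, Matrix.conjTranspose_conjTranspose,
      hρ.1.eq, Matrix.trace_mul_comm, Matrix.trace_mul_comm ρ] at h1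
    exact h1
  have hherm : σ.IsHermitian := by
    refine sub_eq_zero.1 (Matrix.trace_conjTranspose_mul_self_eq_zero_iff.1 ?_)
    have hmem : (σᴴ - σ)ᴴ ∈ S := star_mem (sub_mem (star_mem hσ) hσ)
    rw [Matrix.mul_sub, Matrix.trace_sub, hstar _ hmem, h _ hmem, sub_self]
  have hsa : IsSelfAdjoint σ := hherm.isSelfAdjoint
  set m := cfc (fun x : ℝ => √(max (-x) 0)) σ with hm
  set q := cfc (fun x : ℝ => √(max x 0)) σ with hq
  have hmh : mᴴ = m := cfc_predicate (R := ℝ) (p := IsSelfAdjoint) _ σ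
  have hqh : qᴴ = q := cfc_predicate (R := ℝ) (p := IsSelfAdjoint) _ σ
  have hmS : m ∈ S := cfc_mem_of_isHermitian S hherm hσ _
  have hdecomp : σ = q * q - m * m := by
    rw [hm, hq, ← cfc_mul .., ← cfc_mul .., ← cfc_sub ..]
    conv_lhs => rw [← cfc_id' ℝ σ]
    refine cfc_congr fun x _ => ?_
    simp only [Real.mul_self_sqrt (le_max_right _ _)]
    rcases le_total x 0 with hx | hx <;> simp [hx]
  have horth : m * q = 0 := by
    rw [hm, hq, ← cfc_mul .., ← cfc_const_zero ℝ σ]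
    refine cfc_congr fun x _ => ?_
    rcases le_total x 0 with hx | hx <;> simp [hx]
  have hnσ : (m * m) * σ = -((m * m)ᴴ * (m * m)) := by
    rw [Matrix.conjTranspose_mul, hmh]
    nth_rewrite 1 [hdecomp]
    rw [Matrix.mul_sub, Matrix.mul_assoc m m (q * q), ← Matrix.mul_assoc m q q, horth]
    simp
  have hpos : 0 ≤ ((m * m) * ρ).trace := by
    have h1 := (hρ.mul_mul_conjTranspose_same m).trace_nonneg
    rwa [hmh, Matrix.trace_mul_comm, ← Matrix.mul_assoc] at h1
  rw [← h _ (mul_mem hmS hmS), hnσ, Matrix.trace_neg, neg_nonneg] at hpos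
  have hzero : m * m = 0 := Matrix.trace_conjTranspose_mul_self_eq_zero_iff.1
    (le_antisymm hpos (Matrix.posSemidef_conjTranspose_mul_self _).trace_nonneg)
  rw [hdecomp, hzero, sub_zero]
  nth_rewrite 1 [← hqh]
  exact Matrix.posSemidef_conjTranspose_mul_self q

theorem convex_support_from_generated_star_algebra {d r : ℕ}
    (u : Fin r → Matrix (Fin d) (Fin d) ℂ) (hu : ∀ i, (u i).IsHermitian) :
    expVal u '' stateSpace d =
      expVal u '' (stateSpace d ∩
        (StarAlgebra.adjoin ℂ ({(1 : Matrix (Fin d) (Fin d) ℂ)} ∪ Set.range u) :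
          Set (Matrix (Fin d) (Fin d) ℂ))) := by
  refine subset_antisymm ?_ (image_mono inter_subset_left)
  rintro _ ⟨ρ, ⟨hρ, htr⟩, rfl⟩
  obtain ⟨σ, hσ, h⟩ := exists_mem_trace_mul_eq (StarAlgebra.adjoin ℂ ({1} ∪ Set.range u)) ρ
  refine ⟨σ, ⟨⟨posSemidef_of_trace_mul_eq _ hρ hσ h, ?_⟩, hσ⟩, ?_⟩
  · simpa [htr] using h 1 (one_mem _)
  · funext i
    exact congrArg Complex.re
      (h _ (StarAlgebra.subset_adjoin ℂ _ (Or.inr (Set.mem_range_self i))))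
end
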